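/- arXiv:2209.10539 — 2 statements merged into one kernel-verified Lean document; each statement's English description precedes it below -/
import Mathlib

section
/- Every rank-r unit matrix hypergraph G = (S, A) with A ∈ ℝ^{m×n} whose rows are all nonzero admits e·n-bounded group leverage score overestimates; that is, there exist τ ∈ ℝ_{≥0}^k with ‖τ‖₁ ≤ e·n and associated weights w ∈ ℝ_{≥0}^m such that Σ_{j∈S_i} w_j = 1 for every i ∈ [k] and a_j^⊤ (A^⊤ W A)^† a_j ≤ τ_i for every i ∈ [k] and j ∈ S_i, where W = diag(w). -/
open Finset Matrix Real MeasureTheory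
open scoped Classical

/-- The Moore–Penrose pseudoinverse of a square real matrix, defined as the (unique, when it
exists) matrix satisfying the four Penrose conditions, and `0` if no such matrix exists. -/
noncomputable def mpinv {n : ℕ} (M : Matrix (Fin n) (Fin n) ℝ) : Matrix (Fin n) (Fin n) ℝ :=
  if h : ∃ X : Matrix (Fin n) (Fin n) ℝ,
      M * X * M = M ∧ X * M * X = X ∧ (M * X)ᵀ = M * X ∧ (X * M)ᵀ = X * M
  then h.choose else 0

/-- `gval A T x = max_{j ∈ T} |⟨a_j, x⟩|`, where `a_j` are the rows of `A`. -/
noncomputable def gval {m n : ℕ} (A : Matrix (Fin m) (Fin n) ℝ) (T : Finset (Fin m))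
    (x : Fin n → ℝ) : ℝ :=
  if h : T.Nonempty then T.sup' h (fun j => |A j ⬝ᵥ x|) else 0

/-- The orthogonal projection onto the kernel of a real matrix, as a symmetric idempotent matrix. -/
lemma exists_kernel_projection {m n : ℕ} (A : Matrix (Fin m) (Fin n) ℝ) :
    ∃ P : Matrix (Fin n) (Fin n) ℝ,
      Pᵀ = P ∧ P * P = P ∧ A * P = 0 ∧ ∀ x, A *ᵥ x = 0 → P *ᵥ x = x := by
  let K : Submodule ℝ (EuclideanSpace ℝ (Fin n)) := (Matrix.toEuclideanLin A).ker
  let e := Matrix.toEuclideanCLM (n := Fin n) (𝕜 := ℝ)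
  obtain ⟨P, hP⟩ : ∃ P, e P = K.starProjection := e.surjective _
  have hmul (x : Fin n → ℝ) : P *ᵥ x = WithLp.ofLp (K.starProjection (WithLp.toLp 2 x)) := by
    rw [← hP]
    exact (Matrix.ofLp_toEuclideanCLM P (WithLp.toLp 2 x)).symm
  refine ⟨P, ?_, ?_, ?_, fun x hx => ?_⟩
  · have h : star P = P := EquivLike.injective e (by
      rw [map_star, hP]
      exact isSelfAdjoint_starProjection K)
    simpa [Matrix.star_eq_conjTranspose] using h
  · refine EquivLike.injective e ?_
    rw [map_mul, hP]
    exact K.isIdempotentElem_starProjection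
  · refine Matrix.ext_of_mulVec_single fun j => ?_
    rw [← Matrix.mulVec_mulVec, hmul, Matrix.zero_mulVec]
    have h := K.starProjection_apply_mem (WithLp.toLp 2 (Pi.single j 1))
    have h' := congrArg WithLp.ofLp (LinearMap.mem_ker.mp h)
    simpa using h'
  · rw [hmul, Submodule.starProjection_eq_self_iff.mpr]
    exact LinearMap.mem_ker.mpr (by simp [hx])

lemma mpinv_dotProduct {n : ℕ} {M X : Matrix (Fin n) (Fin n) ℝ} (hM : Mᵀ = M)
    (h₁ : M * X * M = M) (h₂ : X * M * X = X) (h₃ : (M * X)ᵀ = M * X) (h₄ : (X * M)ᵀ = X * M)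
    {a : Fin n → ℝ} (ha : (M * X) *ᵥ a = a) :
    a ⬝ᵥ (mpinv M *ᵥ a) = a ⬝ᵥ (X *ᵥ a) := by
  have hex : ∃ X : Matrix (Fin n) (Fin n) ℝ,
      M * X * M = M ∧ X * M * X = X ∧ (M * X)ᵀ = M * X ∧ (X * M)ᵀ = X * M :=
    ⟨X, h₁, h₂, h₃, h₄⟩
  have hp : M * mpinv M * M = M := by
    rw [mpinv, dif_pos hex]
    exact hex.choose_spec.1
  have key (Y : Matrix (Fin n) (Fin n) ℝ) (hY : M * Y * M = M) :
      a ⬝ᵥ (Y *ᵥ a) = (X *ᵥ a) ⬝ᵥ (M *ᵥ (X *ᵥ a)) := by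
    have ha' : M *ᵥ (X *ᵥ a) = a := by rw [Matrix.mulVec_mulVec, ha]
    calc a ⬝ᵥ (Y *ᵥ a) = (M *ᵥ (X *ᵥ a)) ⬝ᵥ (Y *ᵥ (M *ᵥ (X *ᵥ a))) := by rw [ha']
      _ = (X *ᵥ a) ⬝ᵥ ((M * Y * M) *ᵥ (X *ᵥ a)) := by
        nth_rw 1 [← hM]
        rw [Matrix.mulVec_transpose, ← Matrix.dotProduct_mulVec]
        simp only [Matrix.mulVec_mulVec, Matrix.mul_assoc]
      _ = _ := by rw [hY]
  rw [key _ hp, key _ h₁]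

/-- If `det (1 + t E) ≤ 1` for all `t ∈ (0, 1]`, then `E` has nonpositive trace. -/
lemma trace_nonpos_of_det_one_add_smul_le {n : ℕ} (E : Matrix (Fin n) (Fin n) ℝ)
    (h : ∀ t : ℝ, 0 < t → t ≤ 1 → (1 + t • E).det ≤ 1) : E.trace ≤ 0 := by
  set q := (Matrix.det (1 + (Polynomial.X : Polynomial ℝ) • E.map Polynomial.C)).divX.divX
    with hq
  have hcont : Filter.Tendsto (fun t : ℝ => E.trace + q.eval t * t) (nhdsWithin 0 (Set.Ioi 0))
      (nhds (E.trace + q.eval 0 * 0)) :=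
    ((continuous_const.add (q.continuous.mul continuous_id)).tendsto 0).mono_left
      nhdsWithin_le_nhds
  rw [mul_zero, add_zero] at hcont
  refine le_of_tendsto hcont ?_
  filter_upwards [Ioc_mem_nhdsGT (zero_lt_one' ℝ)] with t ht
  have := h t ht.1 ht.2
  rw [Matrix.det_one_add_smul, ← hq] at this
  nlinarith [ht.1]

lemma trace_mul_transpose_diagonal_mul {m n : ℕ} (N : Matrix (Fin n) (Fin n) ℝ)
    (A : Matrix (Fin m) (Fin n) ℝ) (v : Fin m → ℝ) :
    (N * (Aᵀ * Matrix.diagonal v * A)).trace = ∑ j, v j * (A j ⬝ᵥ (N *ᵥ A j)) := by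
  rw [Matrix.mul_assoc, ← Matrix.mul_assoc, Matrix.trace_mul_comm, Matrix.mul_assoc,
    Matrix.trace]
  refine Finset.sum_congr rfl fun j _ => ?_
  rw [Matrix.diag_apply, Matrix.diagonal_mul]
  congr 1

/-- Weights that are nonnegative and sum to one on every group. -/
def groupWeights {m k : ℕ} (S : Fin k → Finset (Fin m)) : Set (Fin m → ℝ) :=
  {w | (∀ j, 0 ≤ w j) ∧ ∀ i, ∑ j ∈ S i, w j = 1}

lemma isCompact_groupWeights {m k : ℕ} {S : Fin k → Finset (Fin m)}
    (hcover : ∀ a : Fin m, ∃ i, a ∈ S i) : IsCompact (groupWeights S) := by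
  refine (isCompact_univ_pi fun _ : Fin m => isCompact_Icc (a := (0 : ℝ)) (b := 1)).of_isClosed_subset
    ?_ fun w hw j _ => ⟨hw.1 j, ?_⟩
  · simp only [groupWeights, Set.ofPred_and, Set.ofPred_forall]
    exact (isClosed_iInter fun j => isClosed_le continuous_const (continuous_apply j)).inter
      (isClosed_iInter fun i => isClosed_eq (by fun_prop) continuous_const)
  · obtain ⟨i, hi⟩ := hcover j
    exact (Finset.single_le_sum (fun l _ => hw.1 l) hi).trans (hw.2 i).le

lemma posSemidef_transpose_diagonal_mul {m n : ℕ} (A : Matrix (Fin m) (Fin n) ℝ)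
    {w : Fin m → ℝ} (hw : ∀ j, 0 ≤ w j) : (Aᵀ * Matrix.diagonal w * A).PosSemidef := by
  simpa using (Matrix.PosSemidef.diagonal hw).conjTranspose_mul_mul_same A

theorem stmt_5 {m n k r : ℕ} (A : Matrix (Fin m) (Fin n) ℝ)
    (S : Fin k → Finset (Fin m))
    -- `S` is a partition of `[m]` into nonempty groups
    (hS : ∀ i, (S i).Nonempty)
    (hdisj : ∀ i j, i ≠ j → Disjoint (S i) (S j))
    (hcover : ∀ a : Fin m, ∃ i, a ∈ S i)
    -- the rank `r = max_i |S_i|` is at least 2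
    (hr : ∀ i, (S i).card ≤ r) (hrmax : ∃ i, (S i).card = r) (hr2 : 2 ≤ r)
    -- all rows of `A` are nonzero
    (hA : ∀ j, A j ≠ 0) :
    ∃ (τ : Fin k → ℝ) (w : Fin m → ℝ),
      (∀ i, 0 ≤ τ i) ∧ (∀ j, 0 ≤ w j) ∧
      (∑ i, τ i ≤ Real.exp 1 * n) ∧
      (∀ i, ∑ j ∈ S i, w j = 1) ∧
      (∀ i, ∀ j ∈ S i,
        A j ⬝ᵥ ((mpinv (Aᵀ * Matrix.diagonal w * A)) *ᵥ A j) ≤ τ i) := by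
  obtain ⟨P, hPt, hPP, hAP, hPker⟩ := exists_kernel_projection A
  have hPA : P * Aᵀ = 0 := by
    rw [← hPt, ← Matrix.transpose_mul, hAP, Matrix.transpose_zero]
  have hPpsd : P.PosSemidef := by
    have := Matrix.posSemidef_conjTranspose_mul_self P
    rwa [Matrix.conjTranspose_eq_transpose_of_trivial, hPt, hPP] at this
  let M (w : Fin m → ℝ) : Matrix (Fin n) (Fin n) ℝ := Aᵀ * Matrix.diagonal w * A
  have hMpsd {w : Fin m → ℝ} (hw : ∀ j, 0 ≤ w j) : (M w).PosSemidef :=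
    posSemidef_transpose_diagonal_mul A hw
  -- The uniform weights make `M + P` nonsingular.
  obtain ⟨u, hu, hupos⟩ : ∃ u ∈ groupWeights S, ∀ j, 0 < u j := by
    choose g hg using hcover
    refine ⟨fun j => ((S (g j)).card : ℝ)⁻¹, ⟨fun j => by positivity, fun i => ?_⟩, fun j => ?_⟩
    · have hgi : ∀ j ∈ S i, g j = i := fun j hj => by
        by_contra hne
        exact Finset.disjoint_left.mp (hdisj _ _ hne) (hg j) hj
      have hconst : ∀ j ∈ S i, ((S (g j)).card : ℝ)⁻¹ = ((S i).card : ℝ)⁻¹ :=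
        fun j hj => by rw [hgi j hj]
      rw [Finset.sum_congr rfl hconst, Finset.sum_const, nsmul_eq_mul]
      exact mul_inv_cancel₀ (by exact_mod_cast (hS i).card_pos.ne')
    · exact inv_pos.mpr (by exact_mod_cast (hS (g j)).card_pos)
  have hudet : 0 < (M u + P).det := by
    refine Matrix.PosDef.det_pos ?_
    rw [((hMpsd hu.1).add hPpsd).posDef_iff_isUnit, ← Matrix.mulVec_injective_iff_isUnit,
      ← Matrix.coe_mulVecLin, ← LinearMap.ker_eq_bot, LinearMap.ker_eq_bot']
    intro x hx
    have hx : (M u + P) *ᵥ x = 0 := hx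
    have hPx : P *ᵥ x = 0 := by
      have := congrArg (P *ᵥ ·) hx
      simpa [M, Matrix.mul_add, hPP, ← Matrix.mul_assoc, hPA] using this
    have hMx : M u *ᵥ x = 0 := by simpa [Matrix.add_mulVec, hPx] using hx
    have hAx : A *ᵥ x = 0 := by
      have hpd : (Matrix.diagonal u).PosDef := Matrix.PosDef.diagonal hupos
      by_contra hne
      have := hpd.dotProduct_mulVec_pos hne
      have heq : x ⬝ᵥ (M u *ᵥ x) = (A *ᵥ x) ⬝ᵥ (Matrix.diagonal u *ᵥ (A *ᵥ x)) := by
        rw [← Matrix.mulVec_mulVec, ← Matrix.mulVec_mulVec, Matrix.dotProduct_mulVec,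
          Matrix.vecMul_transpose]
      rw [star_trivial, ← heq, hMx, dotProduct_zero] at this
      exact lt_irrefl _ this
    rw [← hPker x hAx, hPx]
  obtain ⟨w, hw, hmax⟩ := (isCompact_groupWeights hcover).exists_isMaxOn ⟨u, hu⟩
    (f := fun w => (M w + P).det) (by fun_prop)
  have hdet : 0 < (M w + P).det := hudet.trans_le (hmax hu)
  set N := M w + P with hN
  have hNunit : IsUnit N.det := hdet.ne'.isUnit
  have hMP : M w * P = 0 := by simp [M, Matrix.mul_assoc, hAP]
  have hPM : P * M w = 0 := by simp [M, ← Matrix.mul_assoc, hPA]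
  have hNP : N⁻¹ * P = P := by
    have : N * P = P := by rw [hN, add_mul, hMP, hPP, zero_add]
    conv_lhs => rw [← this, Matrix.nonsing_inv_mul_cancel_left _ _ hNunit]
  have hPN : P * N⁻¹ = P := by
    have : P * N = P := by rw [hN, mul_add, hPM, hPP, zero_add]
    conv_lhs => rw [← this, Matrix.mul_nonsing_inv_cancel_right _ _ hNunit]
  have hMeq : M w = N - P := by rw [hN, add_sub_cancel_right]
  have hMX : M w * (N⁻¹ - P) = 1 - P := by
    rw [mul_sub, hMP, hMeq, sub_mul, Matrix.mul_nonsing_inv _ hNunit, hPN, sub_zero]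
  have hXM : (N⁻¹ - P) * M w = 1 - P := by
    rw [sub_mul, hPM, hMeq, mul_sub, Matrix.nonsing_inv_mul _ hNunit, hNP, sub_zero]
  have hProw (j : Fin m) : P *ᵥ A j = 0 := by
    ext l
    exact congrFun (congrFun hPA l) j
  let ℓ (j : Fin m) : ℝ := A j ⬝ᵥ (N⁻¹ *ᵥ A j)
  have hℓ (j : Fin m) : A j ⬝ᵥ (mpinv (M w) *ᵥ A j) = ℓ j := by
    rw [mpinv_dotProduct (X := N⁻¹ - P)]
    · rw [Matrix.sub_mulVec, hProw, sub_zero]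
    · simpa using (hMpsd hw.1).isHermitian.eq
    · rw [hMX, sub_mul, hPM, one_mul, sub_zero]
    · rw [hXM, sub_mul, mul_sub P, hPN, hPP, one_mul, sub_self, sub_zero]
    · simp [hMX, hPt]
    · simp [hXM, hPt]
    · rw [hMX, Matrix.sub_mulVec, hProw, Matrix.one_mulVec, sub_zero]
  have hℓ0 (j : Fin m) : 0 ≤ ℓ j := by
    simpa using ((hMpsd hw.1).add hPpsd).inv.dotProduct_mulVec_nonneg (A j)
  -- First-order optimality of `w`.
  have hopt {v : Fin m → ℝ} (hv : v ∈ groupWeights S) : ∑ j, (v j - w j) * ℓ j ≤ 0 := by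
    have htr := trace_mul_transpose_diagonal_mul N⁻¹ A (v - w)
    refine htr.symm.trans_le (trace_nonpos_of_det_one_add_smul_le _ fun t ht0 ht1 => ?_)
    have hmem : w + t • (v - w) ∈ groupWeights S := by
      refine ⟨fun j => ?_, fun i => ?_⟩
      · have h1 := hw.1 j
        have h2 := hv.1 j
        simp only [Pi.add_apply, Pi.smul_apply, Pi.sub_apply, smul_eq_mul]
        nlinarith
      · simp [Finset.sum_add_distrib, ← Finset.mul_sum, hw.2 i, hv.2 i]
    have hle : (M (w + t • (v - w)) + P).det ≤ N.det := hmax hmem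
    have hfac : M (w + t • (v - w)) + P = N * (1 + t • (N⁻¹ * M (v - w))) := by
      rw [mul_add, Matrix.mul_smul, Matrix.mul_nonsing_inv_cancel_left _ _ hNunit, mul_one, hN]
      have hdiag : Matrix.diagonal (w + t • (v - w)) =
          Matrix.diagonal w + t • Matrix.diagonal (v - w) := by
        rw [← Matrix.diagonal_smul, Matrix.diagonal_add]
        rfl
      simp only [M, hdiag, Matrix.mul_add, Matrix.add_mul, Matrix.mul_smul, Matrix.smul_mul]
      abel
    rw [hfac, Matrix.det_mul] at hle
    exact le_of_mul_le_mul_left (by simpa using hle) hdet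
  refine ⟨fun i => ∑ j ∈ S i, w j * ℓ j, w,
    fun i => Finset.sum_nonneg fun j _ => mul_nonneg (hw.1 j) (hℓ0 j), hw.1, ?_, hw.2,
    fun i j hj => ?_⟩
  · have hsum : ∑ i, ∑ j ∈ S i, w j * ℓ j = ∑ j, w j * ℓ j := by
      rw [← Finset.sum_biUnion fun i _ i' _ h => hdisj i i' h]
      congr 1
      ext j
      simpa using hcover j
    have htr : ∑ j, w j * ℓ j = n - P.trace := by
      rw [← trace_mul_transpose_diagonal_mul N⁻¹ A w]
      change (N⁻¹ * M w).trace = _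
      rw [hMeq, mul_sub, Matrix.nonsing_inv_mul _ hNunit, hNP, Matrix.trace_sub,
        Matrix.trace_one, Fintype.card_fin]
    have hn : (0 : ℝ) ≤ n := n.cast_nonneg
    have he : 1 ≤ Real.exp 1 := Real.one_le_exp zero_le_one
    rw [hsum, htr]
    nlinarith [hPpsd.trace_nonneg]
  · let v (l : Fin m) : ℝ := if l ∈ S i then (if l = j then 1 else 0) else w l
    have hv : v ∈ groupWeights S := by
      refine ⟨fun l => ?_, fun i' => ?_⟩
      · have := hw.1 l
        dsimp only [v]
        split_ifs <;> simp [this]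
      · by_cases h : i' = i
        · subst h
          rw [Finset.sum_congr rfl fun l hl => if_pos hl]
          simp [hj]
        · rw [Finset.sum_congr rfl fun l hl =>
            if_neg (Finset.disjoint_left.mp (hdisj _ _ h) hl)]
          exact hw.2 i'
    have hdiff : ∑ l, (v l - w l) * ℓ l = ℓ j - ∑ l ∈ S i, w l * ℓ l := by
      rw [← Finset.sum_subset (Finset.subset_univ (S i)) fun l _ hl => by simp [v, hl]]
      rw [Finset.sum_congr rfl fun l hl => by
        rw [sub_mul, show v l = if l = j then 1 else 0 from if_pos hl]]
      simp [hj]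
    change A j ⬝ᵥ (mpinv (M w) *ᵥ A j) ≤ _
    rw [hℓ]
    linarith [hopt hv]
end

section
/- Let G = (S, A) be a unit matrix hypergraph with sampling probabilities p_i ∈ (0,1], and let d̂ be the modified distance. Then for all x, y, z ∈ ℝ^n: d̂(x, y) ≤ 8 · (d̂(x, z) + d̂(y, z)). -/
open Finset Matrix Real MeasureTheory
open scoped Classical

/-- The modified distance
`d̂(x,y) = (Σ_i 1_{p_i ≠ 1} p_i⁻¹ (g_i(x) + g_i(y))² g_i(x-y)²)^{1/2}`. -/
noncomputable def dHat {m n k : ℕ} (A : Matrix (Fin m) (Fin n) ℝ)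
    (S : Fin k → Finset (Fin m)) (p : Fin k → ℝ) (x y : Fin n → ℝ) : ℝ :=
  Real.sqrt (∑ i, (if p i = 1 then 0 else (p i)⁻¹) *
    (gval A (S i) x + gval A (S i) y) ^ 2 * (gval A (S i) (x - y)) ^ 2)

theorem gval_nonneg {m n : ℕ} (A : Matrix (Fin m) (Fin n) ℝ) (T : Finset (Fin m))
    (x : Fin n → ℝ) : 0 ≤ gval A T x := by
  unfold gval
  split_ifs with h
  · obtain ⟨j, hj⟩ := h
    exact (abs_nonneg (A j ⬝ᵥ x)).trans (Finset.le_sup' (fun j => |A j ⬝ᵥ x|) hj)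
  · exact le_rfl

theorem gval_sub_le {m n : ℕ} (A : Matrix (Fin m) (Fin n) ℝ) (T : Finset (Fin m))
    (x y : Fin n → ℝ) : gval A T (x - y) ≤ gval A T x + gval A T y := by
  unfold gval
  split_ifs with h
  · refine Finset.sup'_le _ _ fun j hj => ?_
    rw [dotProduct_sub]
    exact (abs_sub _ _).trans (add_le_add (Finset.le_sup' (fun j => |A j ⬝ᵥ x|) hj)
      (Finset.le_sup' (fun j => |A j ⬝ᵥ y|) hj))
  · simp

theorem gval_neg {m n : ℕ} (A : Matrix (Fin m) (Fin n) ℝ) (T : Finset (Fin m))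
    (x : Fin n → ℝ) : gval A T (-x) = gval A T x := by
  simp [gval]

theorem gval_add_le {m n : ℕ} (A : Matrix (Fin m) (Fin n) ℝ) (T : Finset (Fin m))
    (x y : Fin n → ℝ) : gval A T (x + y) ≤ gval A T x + gval A T y := by
  simpa [gval_neg] using gval_sub_le A T x (-y)

theorem gval_add_mul_gval_sub_le {m n : ℕ} (A : Matrix (Fin m) (Fin n) ℝ) (T : Finset (Fin m))
    (x y z : Fin n → ℝ) :
    (gval A T x + gval A T y) * gval A T (x - y) ≤
      3 * ((gval A T x + gval A T z) * gval A T (x - z) +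
        (gval A T y + gval A T z) * gval A T (y - z)) := by
  have hx := gval_nonneg A T x
  have hy := gval_nonneg A T y
  have hz := gval_nonneg A T z
  have hxz := gval_nonneg A T (x - z)
  have hyz := gval_nonneg A T (y - z)
  have hxz_le := gval_sub_le A T x z
  have hyz_le := gval_sub_le A T y z
  have hx_le : gval A T x ≤ gval A T z + gval A T (x - z) := by
    simpa using gval_add_le A T z (x - z)
  have hy_le : gval A T y ≤ gval A T z + gval A T (y - z) := by
    simpa using gval_add_le A T z (y - z)
  have hxy_le : gval A T (x - y) ≤ gval A T (x - z) + gval A T (y - z) := by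
    simpa using gval_sub_le A T (x - z) (y - z)
  generalize gval A T x = a at *
  generalize gval A T y = b at *
  generalize gval A T z = c at *
  generalize gval A T (x - z) = u at *
  generalize gval A T (y - z) = v at *
  have hw := mul_le_mul_of_nonneg_left hxy_le (add_nonneg hx hy)
  have hav := mul_le_mul_of_nonneg_right hx_le hyz
  have hbu := mul_le_mul_of_nonneg_right hy_le hxz
  have huu := mul_le_mul_of_nonneg_right hxz_le hxz
  have hvv := mul_le_mul_of_nonneg_right hyz_le hyz
  nlinarith [sq_nonneg (u - v), mul_nonneg hx hxz, mul_nonneg hy hyz, mul_nonneg hz hxz,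
    mul_nonneg hz hyz]

theorem stmt_14 {m n k : ℕ} (A : Matrix (Fin m) (Fin n) ℝ)
    (S : Fin k → Finset (Fin m))
    -- `S` is a partition of `[m]` into nonempty groups
    (hS : ∀ i, (S i).Nonempty)
    (hdisj : ∀ i j, i ≠ j → Disjoint (S i) (S j))
    (hcover : ∀ a : Fin m, ∃ i, a ∈ S i)
    -- sampling probabilities
    (p : Fin k → ℝ) (hp : ∀ i, 0 < p i ∧ p i ≤ 1)
    (x y z : Fin n → ℝ) :
    dHat A S p x y ≤ 8 * (dHat A S p x z + dHat A S p y z) := by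
  have hc : ∀ i, 0 ≤ (if p i = 1 then 0 else (p i)⁻¹) := fun i => by
    split_ifs
    · exact le_rfl
    · exact inv_nonneg.2 (hp i).1.le
  have hnonneg : ∀ x y : Fin n → ℝ, 0 ≤ ∑ i, (if p i = 1 then 0 else (p i)⁻¹) *
      (gval A (S i) x + gval A (S i) y) ^ 2 * (gval A (S i) (x - y)) ^ 2 := fun x y =>
    Finset.sum_nonneg fun i _ => mul_nonneg (mul_nonneg (hc i) (sq_nonneg _)) (sq_nonneg _)
  have hsum : ∑ i, (if p i = 1 then 0 else (p i)⁻¹) *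
      (gval A (S i) x + gval A (S i) y) ^ 2 * (gval A (S i) (x - y)) ^ 2 ≤
      18 * (∑ i, (if p i = 1 then 0 else (p i)⁻¹) *
        (gval A (S i) x + gval A (S i) z) ^ 2 * (gval A (S i) (x - z)) ^ 2 +
      ∑ i, (if p i = 1 then 0 else (p i)⁻¹) *
        (gval A (S i) y + gval A (S i) z) ^ 2 * (gval A (S i) (y - z)) ^ 2) := by
    rw [← Finset.sum_add_distrib, Finset.mul_sum]
    refine Finset.sum_le_sum fun i _ => ?_
    simp only [mul_assoc, ← mul_pow]
    rw [← mul_add, mul_left_comm]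
    refine mul_le_mul_of_nonneg_left ?_ (hc i)
    have hle := pow_le_pow_left₀ (mul_nonneg
      (add_nonneg (gval_nonneg A (S i) x) (gval_nonneg A (S i) y))
      (gval_nonneg A (S i) (x - y))) (gval_add_mul_gval_sub_le A (S i) x y z) 2
    refine hle.trans ?_
    rw [mul_pow]
    linarith [add_sq_le (a := (gval A (S i) x + gval A (S i) z) * gval A (S i) (x - z))
      (b := (gval A (S i) y + gval A (S i) z) * gval A (S i) (y - z))]
  have hP := hnonneg x z
  have hQ := hnonneg y z
  unfold dHat
  refine Real.sqrt_le_iff.2 ⟨by positivity, hsum.trans ?_⟩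
  nlinarith [Real.sq_sqrt hP, Real.sq_sqrt hQ,
    mul_nonneg (Real.sqrt_nonneg (∑ i, (if p i = 1 then 0 else (p i)⁻¹) *
        (gval A (S i) x + gval A (S i) z) ^ 2 * (gval A (S i) (x - z)) ^ 2))
      (Real.sqrt_nonneg (∑ i, (if p i = 1 then 0 else (p i)⁻¹) *
        (gval A (S i) y + gval A (S i) z) ^ 2 * (gval A (S i) (y - z)) ^ 2))]
end
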